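/- arXiv:2306.05547 — 6 statements merged into one kernel-verified Lean document; each statement's English description precedes it below -/
import Mathlib

section
/- For every natural number n, the following identity holds in R: ∑_{i=0}^{2n} M(i)·L(2n−i) = ∑_{k=0}^{2n} l^k + ( ∑_{i=0}^{n−1} ((n−i) + 2·i·(n−i))·l^{2i+1} + ∑_{i=1}^{n} (i + 2·i·(n−i))·l^{2i} )·(1+t). -/
open Finset

theorem sum_Icc_one_eq_sum_range_succ {A : Type*} [AddCommMonoid A] (f : ℕ → A) (h0 : f 0 = 0)
    (n : ℕ) : ∑ i ∈ Icc 1 n, f i = ∑ i ∈ range (n + 1), f i := by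
  rw [range_eq_Ico, Finset.sum_eq_sum_Ico_succ_bot n.succ_pos, h0, zero_add]
  rfl

theorem sum_range_two_mul {A : Type*} [AddCommMonoid A] (f : ℕ → A) (n : ℕ) :
    ∑ i ∈ range (2 * n), f i = ∑ i ∈ range n, (f (2 * i) + f (2 * i + 1)) := by
  induction n with
  | zero => simp
  | succ n ih =>
    rw [mul_add_one, sum_range_succ, sum_range_succ, ih, sum_range_succ, add_assoc]

/-- Let `R` be a commutative ring and `l, t ∈ R` with `t^2 = 1`.
With `L, M : ℕ → R` as in the paper (encoding the ℤ/2-equivariant compactly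
supported cohomology of Hilbert schemes of points on a nodal union of two lines),
for every natural number `n`:
`∑_{i=0}^{2n} M i * L (2n−i) = ∑_{k=0}^{2n} l^k
  + (∑_{i=0}^{n−1} ((n−i) + 2i(n−i)) l^{2i+1} + ∑_{i=1}^{n} (i + 2i(n−i)) l^{2i}) * (1+t)`. -/
theorem stmt0 {R : Type*} [CommRing R] (l t : R) (ht : t ^ 2 = 1)
    (L M : ℕ → R)
    (hL0 : L 0 = 1)
    (hLeven : ∀ n : ℕ, 1 ≤ n → L (2 * n) = (((n : R) + 1) + (n : R) * t) * l ^ (2 * n))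
    (hLodd : ∀ n : ℕ, 1 ≤ n → L (2 * n - 1) = ((n : R) + (n : R) * t) * l ^ (2 * n - 1))
    (hM0 : M 0 = 1)
    (hMeven : ∀ n : ℕ, 1 ≤ n →
      M (2 * n) = 1 + (n : R) * l + ((n - 1 : ℕ) : R) * l * t)
    (hModd : ∀ n : ℕ, 1 ≤ n →
      M (2 * n - 1) = 1 + ((n - 1 : ℕ) : R) * l + ((n - 1 : ℕ) : R) * l * t)
    (n : ℕ) :
    ∑ i ∈ range (2 * n + 1), M i * L (2 * n - i)
      = ∑ k ∈ range (2 * n + 1), l ^ k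
        + (∑ i ∈ range n, ((n - i + 2 * i * (n - i) : ℕ) : R) * l ^ (2 * i + 1)
          + ∑ i ∈ Icc 1 n, ((i + 2 * i * (n - i) : ℕ) : R) * l ^ (2 * i)) * (1 + t) := by
  have hL_even (i : ℕ) : L (2 * i) = (1 + (i : R) * (1 + t)) * l ^ (2 * i) := by
    rcases Nat.eq_zero_or_pos i with rfl | hi
    · simp [hL0]
    · rw [hLeven i hi]
      ring
  have hL_odd (i : ℕ) : L (2 * i + 1) = ((i : R) + 1) * (1 + t) * l ^ (2 * i + 1) := by
    have h := hLodd (i + 1) (by omega)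
    rw [show 2 * (i + 1) - 1 = 2 * i + 1 by omega] at h
    rw [h]
    push_cast
    ring
  have hpair (i : ℕ) (hi : i ∈ range n) :
      M (2 * n - 2 * i) * L (2 * i) + M (2 * n - (2 * i + 1)) * L (2 * i + 1)
        = l ^ (2 * i) + l ^ (2 * i + 1)
          + (((n - i + 2 * i * (n - i) : ℕ) : R) * l ^ (2 * i + 1)
            + ((i + 2 * i * (n - i) : ℕ) : R) * l ^ (2 * i)) * (1 + t)
          + (2 * (1 + t) * ((i + 1 : ℕ) : R) * ((n : R) - (i + 1 : ℕ)) * l ^ (2 * (i + 1))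
            - 2 * (1 + t) * (i : R) * ((n : R) - i) * l ^ (2 * i)) := by
    obtain ⟨d, rfl⟩ := Nat.exists_eq_add_of_lt (mem_range.mp hi)
    have he := hMeven (d + 1) (by omega)
    have ho := hModd (d + 1) (by omega)
    rw [show 2 * (i + d + 1) - 2 * i = 2 * (d + 1) by omega,
      show 2 * (i + d + 1) - (2 * i + 1) = 2 * (d + 1) - 1 by omega,
      show i + d + 1 - i = d + 1 by omega, he, ho, hL_even, hL_odd, Nat.add_sub_cancel]
    push_cast
    linear_combination
      ((i : R) * d * l ^ (2 * i + 1) + ((i : R) + 1) * d * l ^ (2 * i + 2)) * ht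
  rw [← sum_range_reflect, sum_Icc_one_eq_sum_range_succ _ (by simp)]
  have hreflect : ∑ j ∈ range (2 * n + 1), M (2 * n + 1 - 1 - j) * L (2 * n - (2 * n + 1 - 1 - j))
      = ∑ j ∈ range (2 * n + 1), M (2 * n - j) * L j := by
    refine sum_congr rfl fun j hj => ?_
    rw [Nat.add_sub_cancel, Nat.sub_sub_self (by simpa [Nat.lt_succ_iff] using hj)]
  rw [hreflect, sum_range_succ, sum_range_two_mul, sum_congr rfl hpair, sum_add_distrib,
    sum_range_sub fun i : ℕ => 2 * (1 + t) * (i : R) * ((n : R) - i) * l ^ (2 * i),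
    sum_add_distrib, ← sum_mul, sum_add_distrib, sum_range_succ _ (2 * n),
    sum_range_two_mul, sum_range_succ _ n, Nat.sub_self, Nat.sub_self, hM0, hL_even]
  simp only [sum_add_distrib]
  push_cast
  ring
end

section
/- For every natural number n, the following identity holds in R: ∑_{i=0}^{2n+1} M(i)·L(2n+1−i) = ∑_{i=0}^{n} l^{2n−2i} + ( ∑_{i=0}^{n} (n+1+2·i·(n−i))·l^{2n−2i+1} + ∑_{i=0}^{n} 2·(i+1)·(n−i)·l^{2n−2i} )·(1+t). -/
open Finset

theorem sum_range_two_mul_add_two {A : Type*} [AddCommMonoid A] (f : ℕ → A) (n : ℕ) :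
    ∑ i ∈ range (2 * n + 2), f i = ∑ i ∈ range (n + 1), (f (2 * i) + f (2 * i + 1)) := by
  induction n with
  | zero => simp [sum_range_succ]
  | succ n ih =>
    rw [sum_range_succ _ (n + 1), ← ih, show 2 * (n + 1) + 2 = 2 * n + 2 + 1 + 1 by ring,
      sum_range_succ, sum_range_succ, add_assoc, show 2 * (n + 1) = 2 * n + 2 by ring]

/-- Let `R` be a commutative ring and `l, t ∈ R` with `t^2 = 1`.
With `L, M : ℕ → R` as in the paper, for every natural number `n`:
`∑_{i=0}^{2n+1} M i * L (2n+1−i) = ∑_{i=0}^{n} l^{2n−2i}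
  + (∑_{i=0}^{n} (n+1+2i(n−i)) l^{2n−2i+1} + ∑_{i=0}^{n} 2(i+1)(n−i) l^{2n−2i}) * (1+t)`. -/
theorem stmt1 {R : Type*} [CommRing R] (l t : R) (ht : t ^ 2 = 1)
    (L M : ℕ → R)
    (hL0 : L 0 = 1)
    (hLeven : ∀ n : ℕ, 1 ≤ n → L (2 * n) = (((n : R) + 1) + (n : R) * t) * l ^ (2 * n))
    (hLodd : ∀ n : ℕ, 1 ≤ n → L (2 * n - 1) = ((n : R) + (n : R) * t) * l ^ (2 * n - 1))
    (hM0 : M 0 = 1)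
    (hMeven : ∀ n : ℕ, 1 ≤ n →
      M (2 * n) = 1 + (n : R) * l + ((n - 1 : ℕ) : R) * l * t)
    (hModd : ∀ n : ℕ, 1 ≤ n →
      M (2 * n - 1) = 1 + ((n - 1 : ℕ) : R) * l + ((n - 1 : ℕ) : R) * l * t)
    (n : ℕ) :
    ∑ i ∈ range (2 * n + 2), M i * L (2 * n + 1 - i)
      = ∑ i ∈ range (n + 1), l ^ (2 * n - 2 * i)
        + (∑ i ∈ range (n + 1), ((n + 1 + 2 * i * (n - i) : ℕ) : R) * l ^ (2 * n - 2 * i + 1)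
          + ∑ i ∈ range (n + 1), ((2 * (i + 1) * (n - i) : ℕ) : R) * l ^ (2 * n - 2 * i))
          * (1 + t) := by
  have htt : t * t = 1 := by rw [← sq, ht]
  have hL2 (k : ℕ) : L (2 * k) = ((k : R) + 1 + k * t) * l ^ (2 * k) := by
    rcases k.eq_zero_or_pos with rfl | hk
    · simp [hL0]
    · exact hLeven k hk
  have hL1 (k : ℕ) : L (2 * k + 1) = ((k : R) + 1) * (1 + t) * l ^ (2 * k + 1) := by
    have h := hLodd (k + 1) (by lia)
    rw [show 2 * (k + 1) - 1 = 2 * k + 1 by lia] at h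
    rw [h]
    push_cast
    ring
  have hM1 (k : ℕ) : M (2 * k + 1) = 1 + (k : R) * l * (1 + t) := by
    have h := hModd (k + 1) (by lia)
    rw [show 2 * (k + 1) - 1 = 2 * k + 1 by lia, Nat.add_sub_cancel] at h
    rw [h]
    ring
  have hM2 (k : ℕ) : M (2 * (k + 1)) = 1 + ((k : R) + 1) * l + k * l * t := by
    rw [hMeven (k + 1) (by lia), Nat.add_sub_cancel]
    push_cast
    ring
  have hodd (i : ℕ) (hi : i ∈ range (n + 1)) : M (2 * i + 1) * L (2 * n + 1 - (2 * i + 1))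
      = l ^ (2 * n - 2 * i) + (((n - i : ℕ) : R) * l ^ (2 * n - 2 * i)
        + ((i * (2 * (n - i) + 1) : ℕ) : R) * l ^ (2 * n - 2 * i + 1)) * (1 + t) := by
    obtain ⟨k, rfl⟩ := Nat.exists_eq_add_of_le (mem_range_succ_iff.mp hi)
    rw [show 2 * (i + k) + 1 - (2 * i + 1) = 2 * k by lia,
      show 2 * (i + k) - 2 * i = 2 * k by lia, Nat.add_sub_cancel_left, hM1, hL2]
    push_cast
    linear_combination (i : R) * l * k * l ^ (2 * k) * htt
  have heven : ∑ i ∈ range (n + 1), M (2 * i) * L (2 * n + 1 - 2 * i)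
      = (∑ i ∈ range (n + 1), ((n - i + 1 : ℕ) : R) * l ^ (2 * n - 2 * i + 1)
        + ∑ i ∈ range (n + 1), (((n - i) * (2 * i + 1) : ℕ) : R) * l ^ (2 * n - 2 * i))
          * (1 + t) := by
    rw [sum_range_succ', sum_range_succ', sum_range_succ _ n]
    have h (i : ℕ) (hi : i ∈ range n) : M (2 * (i + 1)) * L (2 * n + 1 - 2 * (i + 1))
        = (((n - (i + 1) + 1 : ℕ) : R) * l ^ (2 * n - 2 * (i + 1) + 1)
          + (((n - i) * (2 * i + 1) : ℕ) : R) * l ^ (2 * n - 2 * i)) * (1 + t) := by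
      obtain ⟨k, rfl⟩ := Nat.exists_eq_add_of_lt (mem_range.mp hi)
      rw [show 2 * (i + k + 1) + 1 - 2 * (i + 1) = 2 * k + 1 by lia,
        show 2 * (i + k + 1) - 2 * (i + 1) = 2 * k by lia,
        show 2 * (i + k + 1) - 2 * i = 2 * k + 2 by lia,
        show i + k + 1 - (i + 1) = k by lia, show i + k + 1 - i = k + 1 by lia, hM2, hL1]
      push_cast
      linear_combination (i : R) * l * (k + 1) * l ^ (2 * k + 1) * htt
    rw [sum_congr rfl h, ← sum_mul, sum_add_distrib]
    simp [hM0, hL1]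
    ring
  rw [sum_range_two_mul_add_two, sum_add_distrib, heven, sum_congr rfl hodd, sum_add_distrib,
    ← sum_mul, add_left_comm, ← add_mul, sum_add_distrib, add_comm (∑ i ∈ range (n + 1), _ * _)
      (∑ i ∈ range (n + 1), ((i * _ : ℕ) : R) * _), add_add_add_comm, ← sum_add_distrib,
    ← sum_add_distrib]
  congr 3 <;> refine sum_congr rfl fun i hi ↦ ?_ <;>
  · obtain ⟨k, rfl⟩ := Nat.exists_eq_add_of_le (mem_range_succ_iff.mp hi)
    rw [Nat.add_sub_cancel_left]
    push_cast
    ring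
end

section
/- For every natural number n, define P(2n) = l·∑_{j=0}^{2n} l^j + l^2·( ∑_{k=0}^{n−1} (∑_{i=0}^{k} l^i)·(∑_{j=0}^{2n−k−1} l^j) )·(1+t) in R. Then P(2n) = l·∑_{i=0}^{2n} M(i)·L(2n−i). -/
open Finset

section GeomSum

variable {R : Type*} [CommRing R]

/-- Summing `(1 - l)(1 + l + ⋯ + l ^ k) = 1 - l ^ (k + 1)` over `k < n`. -/
theorem one_sub_mul_sum_geom_sum (l : R) (n : ℕ) :
    (1 - l) * ∑ k ∈ range n, ∑ i ∈ range (k + 1), l ^ i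
      = (n : R) + 1 - ∑ i ∈ range (n + 1), l ^ i := by
  induction n with
  | zero => simp
  | succ n ih =>
    have h := mul_neg_geom_sum l (n + 1)
    rw [sum_range_succ, mul_add, ih, h, sum_range_succ _ (n + 1)]
    push_cast
    ring

theorem geom_sum_add_two (l : R) (n : ℕ) :
    ∑ i ∈ range (n + 2), l ^ i = 1 + l + l ^ 2 * ∑ i ∈ range n, l ^ i := by
  rw [sum_range_succ', sum_range_succ', mul_sum]
  simp only [pow_succ, ← sum_mul, ← mul_sum]
  ring

/-- Recurrence in `n` for the sums of products of two geometric sums. -/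
theorem sum_geom_sum_mul_geom_sum_succ (l : R) (n : ℕ) :
    ∑ k ∈ range (n + 1), (∑ i ∈ range (k + 1), l ^ i) *
        (∑ j ∈ range (2 * (n + 1) - k - 1 + 1), l ^ j)
      = l ^ 2 * (∑ k ∈ range n, (∑ i ∈ range (k + 1), l ^ i) *
          (∑ j ∈ range (2 * n - k - 1 + 1), l ^ j))
        + (1 + l) * (∑ k ∈ range n, ∑ i ∈ range (k + 1), l ^ i)
        + (∑ i ∈ range (n + 1), l ^ i) * (∑ i ∈ range (n + 2), l ^ i) := by
  rw [sum_range_succ, mul_sum _ _ (l ^ 2), mul_sum _ _ (1 + l), ← sum_add_distrib]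
  congr 1
  · refine sum_congr rfl fun k hk => ?_
    have hk := mem_range.mp hk
    rw [show 2 * (n + 1) - k - 1 + 1 = (2 * n - k - 1 + 1) + 2 by omega, geom_sum_add_two]
    ring
  · rw [show 2 * (n + 1) - n - 1 + 1 = n + 2 by omega]

/-- Closed form, up to the factor `1 + t`, of the sum of the `M i` weighted by powers of `l`. -/
theorem one_add_mul_sum_mul_pow (l t : R) (ht : t ^ 2 = 1) (M : ℕ → R) (hM0 : M 0 = 1)
    (hMeven : ∀ n : ℕ, M (2 * n + 2) = 1 + ((n : R) + 1) * l + (n : R) * l * t)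
    (hModd : ∀ n : ℕ, M (2 * n + 1) = 1 + (n : R) * l + (n : R) * l * t) (n : ℕ) :
    (1 + t) * ∑ i ∈ range (2 * n + 1), M i * l ^ (2 * n + 2 - i)
      = (1 + t) * (l * ((1 + l) * (∑ k ∈ range n, ∑ i ∈ range (k + 1), l ^ i)
          + (∑ i ∈ range (n + 1), l ^ i) * (∑ i ∈ range (n + 2), l ^ i))
        - l - 2 * n * l ^ 2 - n * l) := by
  induction n with
  | zero =>
    simp [hM0, sum_range_succ]
    ring
  | succ n ih =>
    have hsum : ∑ i ∈ range (2 * n + 1), M i * l ^ (2 * (n + 1) + 2 - i)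
        = l ^ 2 * ∑ i ∈ range (2 * n + 1), M i * l ^ (2 * n + 2 - i) := by
      rw [mul_sum]
      refine sum_congr rfl fun i hi => ?_
      have hi := mem_range.mp hi
      rw [show 2 * (n + 1) + 2 - i = (2 * n + 2 - i) + 2 by omega]
      ring
    have hgeom := one_sub_mul_sum_geom_sum l n
    have h2 := geom_sum_add_two l (n + 1)
    have h1 := geom_sum_succ (x := l) (n := n + 1)
    rw [show 2 * (n + 1) + 1 = 2 * n + 1 + 1 + 1 by ring, sum_range_succ, sum_range_succ, hsum,
      show 2 * (n + 1) + 2 - (2 * n + 1) = 3 by omega,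
      show 2 * (n + 1) + 2 - (2 * n + 1 + 1) = 2 by omega, hModd, hMeven,
      sum_range_succ _ n, show n + 1 + 2 = n + 3 by rfl, h2]
    rw [show n + 1 + 1 = n + 2 by rfl] at h1 ⊢
    push_cast
    rw [h1] at ih ⊢
    linear_combination l ^ 2 * ih - (1 + t) * l * (1 + l) ^ 2 * hgeom + n * l ^ 3 * (1 + l) * ht

end GeomSum

/-- Let `R` be a commutative ring and `l, t ∈ R` with `t^2 = 1`.
With `L, M : ℕ → R` as in the paper, for every natural number `n`, setting
`P(2n) = l·∑_{j=0}^{2n} l^j + l^2·(∑_{k=0}^{n−1} (∑_{i=0}^{k} l^i)(∑_{j=0}^{2n−k−1} l^j))·(1+t)`,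
we have `P(2n) = l · ∑_{i=0}^{2n} M i * L (2n−i)`. -/
theorem stmt2 {R : Type*} [CommRing R] (l t : R) (ht : t ^ 2 = 1)
    (L M : ℕ → R)
    (hL0 : L 0 = 1)
    (hLeven : ∀ n : ℕ, 1 ≤ n → L (2 * n) = (((n : R) + 1) + (n : R) * t) * l ^ (2 * n))
    (hLodd : ∀ n : ℕ, 1 ≤ n → L (2 * n - 1) = ((n : R) + (n : R) * t) * l ^ (2 * n - 1))
    (hM0 : M 0 = 1)
    (hMeven : ∀ n : ℕ, 1 ≤ n →
      M (2 * n) = 1 + (n : R) * l + ((n - 1 : ℕ) : R) * l * t)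
    (hModd : ∀ n : ℕ, 1 ≤ n →
      M (2 * n - 1) = 1 + ((n - 1 : ℕ) : R) * l + ((n - 1 : ℕ) : R) * l * t)
    (n : ℕ) :
    l * ∑ j ∈ range (2 * n + 1), l ^ j
      + l ^ 2 * (∑ k ∈ range n,
          (∑ i ∈ range (k + 1), l ^ i) * (∑ j ∈ range (2 * n - k - 1 + 1), l ^ j)) * (1 + t)
      = l * ∑ i ∈ range (2 * n + 1), M i * L (2 * n - i) := by
  have hL2 : ∀ m, L (m + 2) = l ^ 2 * L m + (1 + t) * l ^ (m + 2) := by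
    intro m
    obtain ⟨k, rfl | rfl⟩ := m.even_or_odd'
    · have h := hLeven (k + 1) (by omega)
      rw [show 2 * (k + 1) = 2 * k + 2 by ring] at h
      rcases k.eq_zero_or_pos with rfl | hk
      · simp only [mul_zero, zero_add, hL0] at h ⊢
        rw [h]
        push_cast
        ring
      · rw [h, hLeven k hk]
        push_cast
        ring
    · have h := hLodd (k + 1) (by omega)
      have h' := hLodd (k + 2) (by omega)
      rw [show 2 * (k + 1) - 1 = 2 * k + 1 by omega] at h
      rw [show 2 * (k + 2) - 1 = 2 * k + 1 + 2 by omega] at h'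
      rw [h, h']
      push_cast
      ring
  have hL1 : L 1 = (1 + t) * l := by simpa using hLodd 1 le_rfl
  have hMe : ∀ n : ℕ, M (2 * n + 2) = 1 + ((n : R) + 1) * l + (n : R) * l * t := fun n => by
    simpa [mul_add] using hMeven (n + 1) (by omega)
  have hMo : ∀ n : ℕ, M (2 * n + 1) = 1 + (n : R) * l + (n : R) * l * t := fun n => by
    simpa [mul_add] using hModd (n + 1) (by omega)
  induction n with
  | zero => simp [hM0, hL0]
  | succ n ih =>
    have hsum : ∑ i ∈ range (2 * n + 1), M i * L (2 * (n + 1) - i)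
        = l ^ 2 * ∑ i ∈ range (2 * n + 1), M i * L (2 * n - i)
          + (1 + t) * ∑ i ∈ range (2 * n + 1), M i * l ^ (2 * n + 2 - i) := by
      rw [mul_sum, mul_sum, ← sum_add_distrib]
      refine sum_congr rfl fun i hi => ?_
      have hi := mem_range.mp hi
      rw [show 2 * (n + 1) - i = (2 * n - i) + 2 by omega, hL2,
        show 2 * n + 2 - i = (2 * n - i) + 2 by omega]
      ring
    rw [sum_geom_sum_mul_geom_sum_succ, show 2 * (n + 1) + 1 = 2 * n + 1 + 2 by ring,
      geom_sum_add_two, sum_range_succ _ (2 * n + 1 + 1), sum_range_succ _ (2 * n + 1), hsum,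
      one_add_mul_sum_mul_pow l t ht M hM0 hMe hMo,
      show 2 * (n + 1) - (2 * n + 1) = 1 by omega,
      show 2 * (n + 1) - (2 * n + 1 + 1) = 0 by omega, hMo, hMe, hL0, hL1]
    linear_combination l ^ 2 * ih - n * l ^ 3 * ht
end

section
/- For every natural number n ≥ 1, the following identity holds in the polynomial ring ℤ[X]: ∑_{k=0}^{n−1} (∑_{i=0}^{k} X^i)·(∑_{j=0}^{2n−k−1} X^j) = ∑_{i=0}^{n−1} (n−i)·(2i+1)·X^{2i} + ∑_{i=0}^{n−1} (i+1)·(2n−2i−1)·X^{2i+1}. -/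
open Finset Polynomial

/-- A partial sum with coefficients `(N - i)(2i + 1)` and `(i + 1)(2N - 2i - 1)`, cleared of the
denominator `(x - 1) ^ 2`. -/
theorem sq_sub_one_mul_sum_quadratic_coeff {R : Type*} [CommRing R] (x N : R) (m : ℕ) :
    (x - 1) ^ 2 * ∑ i ∈ range m, ((N - i) * (2 * i + 1) * x ^ (2 * i)
        + (i + 1) * (2 * N - 2 * i - 1) * x ^ (2 * i + 1))
      = N + 1 - ∑ j ∈ range (2 * m), x ^ j - (1 + (2 * m + 1) * (N - m)) * x ^ (2 * m)
        + m * (2 * N - 2 * m + 1) * x ^ (2 * m + 1) := by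
  induction m with
  | zero => simp; ring
  | succ m ih =>
    rw [sum_range_succ, mul_add, ih, show 2 * (m + 1) = 2 * m + 1 + 1 by ring,
      sum_range_succ _ (2 * m + 1), sum_range_succ _ (2 * m)]
    push_cast
    ring

theorem sum_pow_succ_add_sum_pow_two_mul_sub {R : Type*} [CommRing R] (x : R) (n : ℕ) :
    ∑ k ∈ range n, x ^ (k + 1) + ∑ k ∈ range n, x ^ (2 * n - k)
      = ∑ j ∈ range (2 * n), x ^ (j + 1) := by
  rw [two_mul, sum_range_add, ← sum_range_reflect (fun k => x ^ (n + n - k))]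
  congr 1
  refine sum_congr rfl fun k hk => ?_
  have := mem_range.1 hk
  congr 1
  omega

theorem sq_sub_one_mul_sum_geom_mul_geom {R : Type*} [CommRing R] (x : R) (n : ℕ) :
    (x - 1) ^ 2 * ∑ k ∈ range n,
        (∑ i ∈ range (k + 1), x ^ i) * (∑ j ∈ range (2 * n - k), x ^ j)
      = n * x ^ (2 * n + 1) + n - ∑ j ∈ range (2 * n), x ^ (j + 1) := by
  have term : ∀ k ∈ range n,
      (x - 1) ^ 2 * ((∑ i ∈ range (k + 1), x ^ i) * (∑ j ∈ range (2 * n - k), x ^ j))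
        = x ^ (2 * n + 1) + 1 - (x ^ (k + 1) + x ^ (2 * n - k)) := by
    intro k hk
    have := mem_range.1 hk
    have hpow : x ^ (2 * n + 1) = x ^ (k + 1) * x ^ (2 * n - k) := by
      rw [← pow_add]
      congr 1
      omega
    rw [hpow]
    linear_combination ((∑ j ∈ range (2 * n - k), x ^ j) * (x - 1)) * geom_sum_mul x (k + 1)
      + (x ^ (k + 1) - 1) * geom_sum_mul x (2 * n - k)
  rw [mul_sum, sum_congr rfl term, ← sum_pow_succ_add_sum_pow_two_mul_sub, sum_sub_distrib,
    sum_add_distrib, sum_const, card_range, nsmul_eq_mul]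
  simp only [sum_add_distrib, sum_const, card_range, nsmul_eq_mul, mul_one]

/-- For every natural number `n ≥ 1`, in `ℤ[X]`:
`∑_{k=0}^{n−1} (∑_{i=0}^{k} X^i)(∑_{j=0}^{2n−k−1} X^j)
  = ∑_{i=0}^{n−1} (n−i)(2i+1) X^{2i} + ∑_{i=0}^{n−1} (i+1)(2n−2i−1) X^{2i+1}`. -/
theorem stmt4 (n : ℕ) (hn : 1 ≤ n) :
    ∑ k ∈ range n,
        (∑ i ∈ range (k + 1), (X : Polynomial ℤ) ^ i)
          * (∑ j ∈ range (2 * n - k - 1 + 1), (X : Polynomial ℤ) ^ j)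
      = ∑ i ∈ range n, (((n - i) * (2 * i + 1) : ℕ) : Polynomial ℤ) * X ^ (2 * i)
        + ∑ i ∈ range n,
            (((i + 1) * (2 * n - 2 * i - 1) : ℕ) : Polynomial ℤ) * X ^ (2 * i + 1) := by
  have hX : ((X : Polynomial ℤ) - 1) ^ 2 ≠ 0 := pow_ne_zero 2 (X_sub_C_ne_zero 1)
  apply mul_left_cancel₀ hX
  have hL : ∀ k ∈ range n,
      (∑ i ∈ range (k + 1), (X : Polynomial ℤ) ^ i)
          * (∑ j ∈ range (2 * n - k - 1 + 1), (X : Polynomial ℤ) ^ j)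
        = (∑ i ∈ range (k + 1), X ^ i) * (∑ j ∈ range (2 * n - k), X ^ j) := by
    intro k hk
    have := mem_range.1 hk
    rw [show 2 * n - k - 1 + 1 = 2 * n - k by omega]
  have hR : ∀ i ∈ range n,
      (((n - i) * (2 * i + 1) : ℕ) : Polynomial ℤ) * X ^ (2 * i)
          + (((i + 1) * (2 * n - 2 * i - 1) : ℕ) : Polynomial ℤ) * X ^ (2 * i + 1)
        = ((n : Polynomial ℤ) - (i : Polynomial ℤ)) * (2 * (i : Polynomial ℤ) + 1) * X ^ (2 * i)
          + ((i : Polynomial ℤ) + 1) * (2 * (n : Polynomial ℤ) - 2 * (i : Polynomial ℤ) - 1)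
            * X ^ (2 * i + 1) := by
    intro i hi
    obtain ⟨d, rfl⟩ := Nat.exists_eq_add_of_lt (mem_range.1 hi)
    rw [show i + d + 1 - i = d + 1 by omega,
      show 2 * (i + d + 1) - 2 * i - 1 = 2 * d + 1 by omega]
    push_cast
    ring
  rw [sum_congr rfl hL, ← sum_add_distrib, sum_congr rfl hR,
    sq_sub_one_mul_sum_geom_mul_geom, sq_sub_one_mul_sum_quadratic_coeff]
  have hshift := (sum_range_succ' (fun j => (X : Polynomial ℤ) ^ j) (2 * n)).symm.trans
    (sum_range_succ _ _)
  rw [pow_zero] at hshift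
  linear_combination -hshift
end

section
/- For all natural numbers h ≥ 1 and b with 2 ≤ b ≤ 2h, the following identity holds in ℤ: ∑_{k≥0, b+2k ≤ 2h} C(2h, b+2k) − 2·∑_{k≥0, b+2k+1 ≤ 2h} C(2h, b+2k+1) + ∑_{k≥0, b+2k+2 ≤ 2h} C(2h, b+2k+2) = C(2h−2, b−2) − C(2h−2, b). -/
open Finset

theorem sum_filter_choose_of_le (s : Finset ℕ) (n : ℕ) (f : ℕ → ℕ) :
    ∑ k ∈ s.filter (fun k => f k ≤ n), (n.choose (f k) : ℤ) = ∑ k ∈ s, (n.choose (f k) : ℤ) := by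
  refine sum_filter_of_ne fun k _ hk => ?_
  by_contra hlt
  exact hk (by rw [Nat.choose_eq_zero_of_lt (not_le.mp hlt), Nat.cast_zero])

theorem choose_add_two_add_two (n m : ℕ) :
    ((n + 2).choose (m + 2) : ℤ) = n.choose m + 2 * n.choose (m + 1) + n.choose (m + 2) := by
  simp only [Nat.choose_succ_succ', Nat.cast_add]
  ring

theorem sum_range_second_difference_choose (n c N : ℕ) :
    ∑ k ∈ range N, (((n + 2).choose (c + 2 + 2 * k) : ℤ)
        - 2 * (n + 2).choose (c + 2 + 2 * k + 1) + (n + 2).choose (c + 2 + 2 * k + 2))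
      = ((n.choose c : ℤ) - n.choose (c + 2))
        - (n.choose (c + 2 * N) - n.choose (c + 2 * N + 2)) := by
  induction N with
  | zero => simp
  | succ N ih =>
    rw [sum_range_succ, ih, show c + 2 + 2 * N = c + 2 * N + 2 by ring,
      show c + 2 * (N + 1) = c + 2 * N + 2 by ring, choose_add_two_add_two n (c + 2 * N),
      choose_add_two_add_two n (c + 2 * N + 1), choose_add_two_add_two n (c + 2 * N + 2)]
    ring

/-- For all natural numbers `h ≥ 1` and `b` with `2 ≤ b ≤ 2h`, in `ℤ`:
`∑_{k≥0, b+2k ≤ 2h} C(2h, b+2k) − 2 ∑_{k≥0, b+2k+1 ≤ 2h} C(2h, b+2k+1)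
  + ∑_{k≥0, b+2k+2 ≤ 2h} C(2h, b+2k+2) = C(2h−2, b−2) − C(2h−2, b)`.
(Since `b ≥ 2`, every admissible `k` satisfies `k ≤ h − 1`, so indexing over
`k ∈ range (h+1)` with the stated filter captures exactly all `k ≥ 0` satisfying
each side condition.) -/
theorem stmt9 (h b : ℕ) (hh : 1 ≤ h) (hb2 : 2 ≤ b) (hb : b ≤ 2 * h) :
    (∑ k ∈ (range (h + 1)).filter (fun k => b + 2 * k ≤ 2 * h),
        ((2 * h).choose (b + 2 * k) : ℤ))
      - 2 * ∑ k ∈ (range (h + 1)).filter (fun k => b + 2 * k + 1 ≤ 2 * h),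
          ((2 * h).choose (b + 2 * k + 1) : ℤ)
      + ∑ k ∈ (range (h + 1)).filter (fun k => b + 2 * k + 2 ≤ 2 * h),
          ((2 * h).choose (b + 2 * k + 2) : ℤ)
      = ((2 * h - 2).choose (b - 2) : ℤ) - ((2 * h - 2).choose b : ℤ) := by
  obtain ⟨c, rfl⟩ := Nat.exists_eq_add_of_le' hb2
  obtain ⟨n, hn⟩ : ∃ n, 2 * h = n + 2 := ⟨2 * h - 2, by omega⟩
  rw [sum_filter_choose_of_le _ _ (fun k => c + 2 + 2 * k),
    sum_filter_choose_of_le _ _ (fun k => c + 2 + 2 * k + 1),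
    sum_filter_choose_of_le _ _ (fun k => c + 2 + 2 * k + 2),
    mul_sum, ← sum_sub_distrib, ← sum_add_distrib, hn,
    sum_range_second_difference_choose, Nat.add_sub_cancel, Nat.add_sub_cancel,
    Nat.choose_eq_zero_of_lt (show n < c + 2 * (h + 1) by omega),
    Nat.choose_eq_zero_of_lt (show n < c + 2 * (h + 1) + 2 by omega)]
  simp
end

section
/- Let P be the complex projective plane (the projectivization of ℂ³ with its quotient topology), let X = {(a,b) ∈ P × P : a ≠ b} be the complement of the diagonal with the subspace topology, and let Y be the quotient of X by the ℤ/2-action swapping the two coordinates, equipped with the quotient topology. Then the fundamental group of Y at any basepoint is isomorphic to ℤ/2ℤ. -/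
/-- The scaling equivalence relation on nonzero vectors of `ℂ³`: two nonzero vectors are
equivalent iff they differ by a (necessarily nonzero) complex scalar, i.e. they span the
same complex line. -/
def projSetoid : Setoid {v : Fin 3 → ℂ // v ≠ 0} where
  r x y := ∃ c : ℂˣ, (c : ℂ) • (x : Fin 3 → ℂ) = (y : Fin 3 → ℂ)
  iseqv := by
    constructor
    · intro x; exact ⟨1, by simp⟩
    · rintro x y ⟨c, hc⟩
      exact ⟨c⁻¹, by rw [← hc, smul_smul]; simp⟩
    · rintro x y z ⟨c, hc⟩ ⟨d, hd⟩
      exact ⟨d * c, by rw [← hd, ← hc, smul_smul]; norm_num⟩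

/-- The complex projective plane `ℙ²(ℂ)`: the space of complex lines in `ℂ³`, i.e. the
quotient of `ℂ³ \ {0}` by scaling, equipped with the quotient topology (the instance is
found automatically since this is a `Quotient`). -/
abbrev CP2 : Type := Quotient projSetoid

/-- The `ℤ/2`-action identification on the complement of the diagonal in `ℙ²(ℂ) × ℙ²(ℂ)`:
two ordered pairs of distinct lines are equivalent iff they are equal or swapped. -/
def swapSetoid : Setoid {p : CP2 × CP2 // p.1 ≠ p.2} where
  r x y := (y : CP2 × CP2) = (x : CP2 × CP2) ∨ (y : CP2 × CP2) = Prod.swap (x : CP2 × CP2)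
  iseqv := by
    constructor
    · intro x; exact Or.inl rfl
    · rintro x y (h | h)
      · exact Or.inl h.symm
      · exact Or.inr (by rw [h, Prod.swap_swap])
    · rintro x y z (h₁ | h₁) (h₂ | h₂) <;>
        simp_all [Prod.swap_swap]

/-- The locus `Σ` of unordered pairs of distinct lines in `ℙ²(ℂ)`: the quotient of the
complement of the diagonal by the coordinate swap, with the quotient topology. -/
abbrev SigmaLocus : Type := Quotient swapSetoid

open Set Filter Topology unitInterval

/-- If a space is covered by open sets that share a base point, such that every point of a pairwise
intersection is joined to the base point within that intersection, and such that paths with the same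
endpoints inside one of the sets are homotopic in the whole space, then the space is simply
connected. -/
theorem simplyConnectedSpace_of_openCover {X ι : Type*} [TopologicalSpace X] (U : ι → Set X)
    (hU : ∀ i, IsOpen (U i)) (hcover : ∀ x, ∃ i, x ∈ U i) (x₀ : X)
    (hjoin : ∀ i j, ∀ y ∈ U i ∩ U j, JoinedIn (U i ∩ U j) x₀ y)
    (hhom : ∀ i, ∀ x y : X, ∀ p q : Path x y,
      (∀ t, p t ∈ U i) → (∀ t, q t ∈ U i) → p.Homotopic q) :
    SimplyConnectedSpace X := by
  choose i hi using hcover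
  have hex (x : X) : ∃ c : Path x₀ x, ∀ t, c t ∈ U (i x) := by
    obtain ⟨c, hc⟩ := hjoin (i x) (i x) x ⟨hi x, hi x⟩
    exact ⟨c, fun t ↦ (hc t).1⟩
  choose c hc using hex
  have canonical (j : ι) (x : X) (hx : x ∈ U j) :
      ∃ d : Path x₀ x, (∀ t, d t ∈ U j) ∧ (c x).Homotopic d := by
    obtain ⟨d, hd⟩ := hjoin (i x) j x ⟨hi x, hx⟩
    exact ⟨d, fun t ↦ (hd t).2, hhom (i x) _ _ _ _ (hc x) fun t ↦ (hd t).1⟩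
  have local_eq (j : ι) {x y : X} (γ : Path x y) (hγ : ∀ t, γ t ∈ U j) :
      (Path.Homotopic.Quotient.mk (c x)).trans (.mk γ) = .mk (c y) := by
    obtain ⟨d, hd, hcd⟩ := canonical j x (by simpa using hγ 0)
    obtain ⟨e, he, hce⟩ := canonical j y (by simpa using hγ 1)
    rw [Path.Homotopic.Quotient.eq.2 hcd, Path.Homotopic.Quotient.eq.2 hce,
      ← Path.Homotopic.Quotient.mk_trans, Path.Homotopic.Quotient.eq]
    refine hhom j _ _ _ _ (fun t ↦ ?_) he
    have ht : d.trans γ t ∈ range (d.trans γ) := mem_range_self t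
    rw [Path.trans_range] at ht
    rcases ht with ⟨s, hs⟩ | ⟨s, hs⟩
    · exact hs ▸ hd s
    · exact hs ▸ hγ s
  have global_eq {x y : X} (γ : Path x y) :
      (Path.Homotopic.Quotient.mk (c x)).trans (.mk γ) = .mk (c y) := by
    have key (s t : I) : (Path.Homotopic.Quotient.mk (c (γ s))).trans (.mk (γ.subpath s t)) =
        .mk (c (γ t)) := by
      refine PreconnectedSpace.induction₂' (fun s t : I ↦
        (Path.Homotopic.Quotient.mk (c (γ s))).trans (.mk (γ.subpath s t)) = .mk (c (γ t)))
        (fun s ↦ ?_) ⟨fun r s t hrs hst ↦ ?_⟩ s t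
      · have hnhds : γ ⁻¹' U (i (γ s)) ∈ 𝓝 s :=
          ((hU _).preimage γ.continuous).mem_nhds (hi (γ s))
        have hmem : ∀ᶠ t in 𝓝 s, uIcc s t ⊆ γ ⁻¹' U (i (γ s)) :=
          (tendsto_const_nhds.uIcc tendsto_id).eventually (eventually_smallSets_subset.2 hnhds)
        filter_upwards [hmem] with t ht
        refine ⟨local_eq (i (γ s)) _ fun u ↦ ?_, local_eq (i (γ s)) _ fun u ↦ ?_⟩
        · have hu : γ.subpath s t u ∈ range (γ.subpath s t) := mem_range_self u
          rw [Path.range_subpath] at hu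
          exact image_subset_iff.2 ht hu
        · have hu : γ.subpath t s u ∈ range (γ.subpath t s) := mem_range_self u
          rw [Path.range_subpath, uIcc_comm] at hu
          exact image_subset_iff.2 ht hu
      · have hsub : Path.Homotopic.Quotient.mk (γ.subpath r t) =
            (Path.Homotopic.Quotient.mk (γ.subpath r s)).trans (.mk (γ.subpath s t)) := by
          rw [← Path.Homotopic.Quotient.mk_trans, Path.Homotopic.Quotient.eq]
          exact ⟨(Path.Homotopy.subpathTransSubpath γ r s t).symm⟩
        change _ = _ at hrs hst
        rw [hsub, ← Path.Homotopic.Quotient.trans_assoc, hrs, hst]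
    have hcast {a b : X} (ha : a = x) (hb : b = y)
        (h : (Path.Homotopic.Quotient.mk (c a)).trans (.mk (γ.cast ha hb)) = .mk (c b)) :
        (Path.Homotopic.Quotient.mk (c x)).trans (.mk γ) = .mk (c y) := by
      subst ha hb
      exact h
    refine hcast γ.source γ.target ?_
    rw [← Path.subpath_zero_one]
    exact key 0 1
  refine simply_connected_iff_paths_homotopic'.2 ⟨⟨⟨x₀⟩, fun x y ↦ ⟨(c x).symm.trans (c y)⟩⟩, ?_⟩
  intro x y p q
  have h := congrArg (fun a ↦ (Path.Homotopic.Quotient.mk (c x)).symm.trans a)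
    ((global_eq p).trans (global_eq q).symm)
  simpa [← Path.Homotopic.Quotient.trans_assoc, Path.Homotopic.Quotient.eq] using h

/-- Continuous linear functionals on `ℂ³`. -/
abbrev Functional : Type := (Fin 3 → ℂ) →L[ℂ] ℂ

/-- The `2 × 2` minor of the pair of vectors `p` with respect to the functionals `f` and `g`. -/
noncomputable def minor (f g : Functional) (p : (Fin 3 → ℂ) × (Fin 3 → ℂ)) : ℂ :=
  f p.1 * g p.2 - g p.1 * f p.2

theorem continuous_minor (f g : Functional) : Continuous (minor f g) := by
  unfold minor
  fun_prop

theorem minor_smul_smul (f g : Functional) (c d : ℂ) (p : (Fin 3 → ℂ) × (Fin 3 → ℂ)) :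
    minor f g (c • p.1, d • p.2) = c * d * minor f g p := by
  simp only [minor, map_smul, smul_eq_mul]
  ring

namespace CP2

/-- The line spanned by a nonzero vector. -/
def mk (v : {v : Fin 3 → ℂ // v ≠ 0}) : CP2 := Quotient.mk projSetoid v

theorem mk_eq_mk_iff {u v : {v : Fin 3 → ℂ // v ≠ 0}} :
    mk u = mk v ↔ ∃ c : ℂˣ, (c : ℂ) • (u : Fin 3 → ℂ) = v :=
  Quotient.eq (r := projSetoid)

theorem mk_surjective : Function.Surjective mk := Quotient.mk_surjective

theorem continuous_mk : Continuous mk := continuous_quotient_mk'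

theorem isOpenQuotientMap_mk : IsOpenQuotientMap mk := by
  refine ⟨mk_surjective, continuous_mk, fun U hU ↦ ?_⟩
  have hpre : mk ⁻¹' (mk '' U) = ⋃ c : ℂˣ,
      (fun v : {v : Fin 3 → ℂ // v ≠ 0} ↦
        (⟨(c : ℂ) • v.1, smul_ne_zero c.ne_zero v.2⟩ : {v : Fin 3 → ℂ // v ≠ 0})) ⁻¹' U := by
    ext v
    simp only [mem_preimage, mem_image, mem_iUnion]
    constructor
    · rintro ⟨u, hu, huv⟩
      obtain ⟨c, hc⟩ := mk_eq_mk_iff.1 huv.symm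
      exact ⟨c, by simpa only [hc] using hu⟩
    · rintro ⟨c, hc⟩
      exact ⟨_, hc, (mk_eq_mk_iff.2 ⟨c, rfl⟩).symm⟩
  refine isOpen_coinduced.2 ?_
  change IsOpen (mk ⁻¹' (mk '' U))
  rw [hpre]
  exact isOpen_iUnion fun c ↦ hU.preimage (by fun_prop)

theorem mk_eq_mk_iff_mul_eq {u v : {v : Fin 3 → ℂ // v ≠ 0}} :
    mk u = mk v ↔ ∀ i j, u.1 i * v.1 j = u.1 j * v.1 i := by
  rw [mk_eq_mk_iff]
  constructor
  · rintro ⟨c, hc⟩ i j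
    simp only [← hc, Pi.smul_apply, smul_eq_mul]
    ring
  · intro h
    obtain ⟨i, hi⟩ := Function.ne_iff.1 u.2
    have hi' : u.1 i ≠ 0 := hi
    have hv (j) : v.1 i / u.1 i * u.1 j = v.1 j := by
      field_simp
      linear_combination -h i j
    have hc : v.1 i / u.1 i ≠ 0 := by
      intro h0
      exact v.2 (funext fun j ↦ by simp [← hv j, h0])
    exact ⟨Units.mk0 _ hc, funext hv⟩

instance : T2Space CP2 := by
  rw [t2Space_iff_of_isOpenQuotientMap isOpenQuotientMap_mk]
  simp only [mk_eq_mk_iff_mul_eq, ofPred_forall]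
  have h₁ (i) : Continuous fun q : {v : Fin 3 → ℂ // v ≠ 0} × {v : Fin 3 → ℂ // v ≠ 0} ↦ q.1.1 i :=
    (continuous_apply i).comp (continuous_subtype_val.comp continuous_fst)
  have h₂ (i) : Continuous fun q : {v : Fin 3 → ℂ // v ≠ 0} × {v : Fin 3 → ℂ // v ≠ 0} ↦ q.2.1 i :=
    (continuous_apply i).comp (continuous_subtype_val.comp continuous_snd)
  exact isClosed_iInter fun i ↦ isClosed_iInter fun j ↦
    isClosed_eq ((h₁ i).mul (h₂ j)) ((h₁ j).mul (h₂ i))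

/-- A nonzero vector spanning the given line. -/
noncomputable def rep (a : CP2) : Fin 3 → ℂ := (Quotient.out a).1

theorem rep_ne_zero (a : CP2) : a.rep ≠ 0 := (Quotient.out a).2

theorem mk_rep (a : CP2) : mk ⟨a.rep, a.rep_ne_zero⟩ = a := Quotient.out_eq a

theorem exists_rep_mk (v : {v : Fin 3 → ℂ // v ≠ 0}) : ∃ c : ℂˣ, (mk v).rep = (c : ℂ) • v.1 := by
  obtain ⟨c, hc⟩ := mk_eq_mk_iff.1 (mk_rep (mk v)).symm
  exact ⟨c, hc.symm⟩

end CP2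

theorem ne_zero_of_minor_ne_zero {f g : Functional} {p : (Fin 3 → ℂ) × (Fin 3 → ℂ)}
    (h : minor f g p ≠ 0) : p.1 ≠ 0 ∧ p.2 ≠ 0 := by
  constructor <;> intro h0 <;> simp [minor, h0] at h

/-- The pair of distinct lines spanned by two vectors, one of whose minors does not vanish. -/
def spanPair (p : {p : (Fin 3 → ℂ) × (Fin 3 → ℂ) // ∃ f g, minor f g p ≠ 0}) :
    {p : CP2 × CP2 // p.1 ≠ p.2} :=
  ⟨(CP2.mk ⟨p.1.1, by obtain ⟨f, g, h⟩ := p.2; exact (ne_zero_of_minor_ne_zero h).1⟩,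
    CP2.mk ⟨p.1.2, by obtain ⟨f, g, h⟩ := p.2; exact (ne_zero_of_minor_ne_zero h).2⟩), by
    obtain ⟨f, g, h⟩ := p.2
    intro heq
    obtain ⟨c, hc⟩ := CP2.mk_eq_mk_iff.1 heq
    apply h
    simp only at hc
    simp only [minor, ← hc, map_smul, smul_eq_mul]
    ring⟩

theorem continuous_spanPair : Continuous spanPair :=
  ((CP2.continuous_mk.comp (by fun_prop)).prodMk
    (CP2.continuous_mk.comp (by fun_prop))).subtype_mk _

/-- The pairs of lines `(⟨u⟩, ⟨v⟩)` such that `f u ≠ 0` and the minor of `(u, v)` with respect to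
`f` and `g` does not vanish. -/
def chart (f g : Functional) : Set (CP2 × CP2) :=
  {p | f p.1.rep ≠ 0 ∧ minor f g (p.1.rep, p.2.rep) ≠ 0}

theorem mk_mem_chart_iff {f g : Functional} {u v : {v : Fin 3 → ℂ // v ≠ 0}} :
    (CP2.mk u, CP2.mk v) ∈ chart f g ↔ f u ≠ 0 ∧ minor f g (u.1, v.1) ≠ 0 := by
  obtain ⟨c, hc⟩ := CP2.exists_rep_mk u
  obtain ⟨d, hd⟩ := CP2.exists_rep_mk v
  have h := minor_smul_smul f g c d (u.1, v.1)
  simp only at h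
  simp [chart, hc, hd, h]

theorem isOpen_chart (f g : Functional) : IsOpen (chart f g) := by
  rw [← (CP2.isOpenQuotientMap_mk.prodMap CP2.isOpenQuotientMap_mk).isQuotientMap.isOpen_preimage]
  have hpre : Prod.map CP2.mk CP2.mk ⁻¹' chart f g =
      {q | f q.1.1 ≠ 0 ∧ minor f g (q.1.1, q.2.1) ≠ 0} := by
    ext ⟨u, v⟩
    exact mk_mem_chart_iff
  rw [hpre]
  have := continuous_minor f g
  exact (isOpen_ne_fun (by fun_prop) (by fun_prop)).inter
    (isOpen_ne_fun (this.comp (by fun_prop)) (by fun_prop))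

theorem exists_functional_ne_zero {u v : Fin 3 → ℂ} (hu : u ≠ 0) (hv : v ≠ 0) :
    ∃ f : Functional, f u ≠ 0 ∧ f v ≠ 0 := by
  obtain ⟨f, hf⟩ := Module.exists_dual_forall_apply_ne_zero (K := ℂ) ![u, v]
    (by simp [Fin.forall_fin_two, hu, hv])
  exact ⟨LinearMap.toContinuousLinearMap f, by simpa using hf 0, by simpa using hf 1⟩

theorem CP2.smul_rep_sub_smul_rep_ne_zero {p : CP2 × CP2} (hp : p.1 ≠ p.2) {f : Functional}
    (hf : f p.1.rep ≠ 0) : f p.1.rep • p.2.rep - f p.2.rep • p.1.rep ≠ 0 := by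
  intro h
  rw [sub_eq_zero] at h
  apply hp
  rw [← mk_rep p.1, ← mk_rep p.2, mk_eq_mk_iff]
  have hne : f p.2.rep ≠ 0 := by
    intro h0
    rw [h0, zero_smul, smul_eq_zero] at h
    exact h.elim hf p.2.rep_ne_zero
  refine ⟨Units.mk0 (f p.2.rep / f p.1.rep) (div_ne_zero hne hf), ?_⟩
  rw [Units.val_mk0, div_eq_inv_mul, mul_smul, ← h, smul_smul, inv_mul_cancel₀ hf, one_smul]

theorem exists_mem_chart_and_mem_chart {p q : CP2 × CP2} (hp : p.1 ≠ p.2) (hq : q.1 ≠ q.2) :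
    ∃ f g, p ∈ chart f g ∧ q ∈ chart f g := by
  obtain ⟨f, hfp, hfq⟩ := exists_functional_ne_zero p.1.rep_ne_zero q.1.rep_ne_zero
  obtain ⟨g, hgp, hgq⟩ := exists_functional_ne_zero
    (CP2.smul_rep_sub_smul_rep_ne_zero hp hfp) (CP2.smul_rep_sub_smul_rep_ne_zero hq hfq)
  refine ⟨f, g, ⟨hfp, ?_⟩, ⟨hfq, ?_⟩⟩
  · simpa [minor, mul_comm] using hgp
  · simpa [minor, mul_comm] using hgq

theorem spanPair_rep {x : {p : CP2 × CP2 // p.1 ≠ p.2}}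
    (h : ∃ f g, minor f g (x.1.1.rep, x.1.2.rep) ≠ 0) :
    spanPair ⟨(x.1.1.rep, x.1.2.rep), h⟩ = x :=
  Subtype.ext (Prod.ext (CP2.mk_rep _) (CP2.mk_rep _))

theorem spanPair_mem_chart_iff {f g : Functional}
    {p : {p : (Fin 3 → ℂ) × (Fin 3 → ℂ) // ∃ f g, minor f g p ≠ 0}} :
    (spanPair p).1 ∈ chart f g ↔ f p.1.1 ≠ 0 ∧ minor f g p.1 ≠ 0 :=
  mk_mem_chart_iff

/-- The polynomial whose value at `z` is the product of the two expressions defining `chart f g`,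
evaluated at the point with parameter `z` of the complex line through `p` and `q`. -/
theorem exists_polynomial_eval_line (f g : Functional) (p q : (Fin 3 → ℂ) × (Fin 3 → ℂ)) :
    ∃ P : Polynomial ℂ, ∀ z : ℂ,
      P.eval z = f (p + z • (q - p)).1 * minor f g (p + z • (q - p)) := by
  let L (h : Functional) (u v : Fin 3 → ℂ) : Polynomial ℂ :=
    Polynomial.C (h u) + Polynomial.X * Polynomial.C (h (v - u))
  refine ⟨L f p.1 q.1 * (L f p.1 q.1 * L g p.2 q.2 - L g p.1 q.1 * L f p.2 q.2), fun z ↦ ?_⟩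
  simp [L, minor]

theorem joinedIn_chart_inter_chart {f g f' g' : Functional} {x y : {p : CP2 × CP2 // p.1 ≠ p.2}}
    (hx : x.1 ∈ chart f g ∩ chart f' g') (hy : y.1 ∈ chart f g ∩ chart f' g') :
    JoinedIn (Subtype.val ⁻¹' chart f g ∩ Subtype.val ⁻¹' chart f' g') x y := by
  set p := (x.1.1.rep, x.1.2.rep)
  set q := (y.1.1.rep, y.1.2.rep)
  obtain ⟨P, hP⟩ := exists_polynomial_eval_line f g p q
  obtain ⟨Q, hQ⟩ := exists_polynomial_eval_line f' g' p q
  have h₀ : (P * Q).eval 0 ≠ 0 := by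
    simpa [hP, hQ] using ⟨hx.1, hx.2⟩
  have h₁ : (P * Q).eval 1 ≠ 0 := by
    simpa [hP, hQ] using ⟨hy.1, hy.2⟩
  have hPQ : P * Q ≠ 0 := by
    intro h
    simp [h] at h₀
  have hjoin : JoinedIn ({z | (P * Q).IsRoot z}ᶜ : Set ℂ) 0 1 :=
    ((Polynomial.finite_setOfPred_isRoot hPQ).countable.isPathConnected_compl_of_one_lt_rank
      (by simp [Complex.rank_real_complex])).joinedIn 0 h₀ 1 h₁
  have hne (z : ({z | (P * Q).IsRoot z}ᶜ : Set ℂ)) :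
      (f (p + z.1 • (q - p)).1 ≠ 0 ∧ minor f g (p + z.1 • (q - p)) ≠ 0) ∧
      (f' (p + z.1 • (q - p)).1 ≠ 0 ∧ minor f' g' (p + z.1 • (q - p)) ≠ 0) := by
    have hz : (P * Q).eval z.1 ≠ 0 := z.2
    rwa [Polynomial.eval_mul, hP, hQ, mul_ne_zero_iff, mul_ne_zero_iff, mul_ne_zero_iff] at hz
  obtain ⟨γ⟩ := joinedIn_iff_joined h₀ h₁ |>.1 hjoin
  let φ : ({z | (P * Q).IsRoot z}ᶜ : Set ℂ) → {p : CP2 × CP2 // p.1 ≠ p.2} :=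
    fun z ↦ spanPair ⟨p + z.1 • (q - p), f, g, (hne z).1.2⟩
  have hφ : Continuous φ := continuous_spanPair.comp (by fun_prop)
  refine ⟨(γ.map hφ).cast ?_ ?_, fun t ↦ ⟨?_, ?_⟩⟩
  · exact (by simp [φ, p, spanPair_rep] : φ ⟨0, h₀⟩ = x).symm
  · exact (by simp [φ, q, spanPair_rep] : φ ⟨1, h₁⟩ = y).symm
  · exact spanPair_mem_chart_iff.2 (hne (γ t)).1
  · exact spanPair_mem_chart_iff.2 (hne (γ t)).2

/-- The affine coordinates of a pair of lines in `chart f g`: with `u` the representative of the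
first line such that `f u = 1` and `v` the representative of the second line such that the minor of
`(u, v)` is `1`, these are `u`, `v - f v • u` and `f v`. -/
noncomputable def chartCoord (f g : Functional) (p : CP2 × CP2) :
    (Fin 3 → ℂ) × (Fin 3 → ℂ) × ℂ :=
  let D := minor f g (p.1.rep, p.2.rep)
  ((f p.1.rep)⁻¹ • p.1.rep,
    D⁻¹ • (f p.1.rep • p.2.rep - f p.2.rep • p.1.rep),
    f p.1.rep * f p.2.rep / D)

theorem chartCoord_mk (f g : Functional) (u v : {v : Fin 3 → ℂ // v ≠ 0}) :
    chartCoord f g (CP2.mk u, CP2.mk v) =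
      ((f u.1)⁻¹ • u.1,
        (minor f g (u.1, v.1))⁻¹ • (f u.1 • v.1 - f v.1 • u.1),
        f u.1 * f v.1 / minor f g (u.1, v.1)) := by
  obtain ⟨c, hc⟩ := CP2.exists_rep_mk u
  obtain ⟨d, hd⟩ := CP2.exists_rep_mk v
  have h := minor_smul_smul f g c d (u.1, v.1)
  have hc0 := c.ne_zero
  have hd0 := d.ne_zero
  simp only at h
  simp only [chartCoord, hc, hd, h, map_smul, smul_eq_mul, Prod.mk.injEq]
  refine ⟨?_, ?_, ?_⟩
  · rw [smul_smul]
    congr 1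
    field_simp
  · have hsub : (c * f u.1 : ℂ) • (d : ℂ) • v.1 - (d * f v.1 : ℂ) • (c : ℂ) • u.1 =
        (c * d : ℂ) • (f u.1 • v.1 - f v.1 • u.1) := by
      module
    rw [hsub, smul_smul]
    congr 1
    field_simp
  · field_simp

theorem continuousOn_chartCoord (f g : Functional) : ContinuousOn (chartCoord f g) (chart f g) := by
  intro p hp
  refine ContinuousAt.continuousWithinAt ?_
  have hπ := CP2.isOpenQuotientMap_mk.prodMap CP2.isOpenQuotientMap_mk
  obtain ⟨⟨u, v⟩, rfl⟩ := hπ.surjective p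
  rw [← hπ.continuousAt_comp_iff]
  obtain ⟨hu, huv⟩ := mk_mem_chart_iff.1 hp
  have hm := continuous_minor f g
  have heq : chartCoord f g ∘ Prod.map CP2.mk CP2.mk = fun q ↦
      ((f q.1.1)⁻¹ • q.1.1,
        (minor f g (q.1.1, q.2.1))⁻¹ • (f q.1.1 • q.2.1 - f q.2.1 • q.1.1),
        f q.1.1 * f q.2.1 / minor f g (q.1.1, q.2.1)) :=
    funext fun q ↦ chartCoord_mk f g q.1 q.2
  rw [heq]
  refine ContinuousAt.prodMk ?_ (ContinuousAt.prodMk ?_ ?_)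
  · have h : Continuous fun q : {v : Fin 3 → ℂ // v ≠ 0} × {v : Fin 3 → ℂ // v ≠ 0} ↦ f q.1.1 := by
      fun_prop
    exact (h.continuousAt.inv₀ hu).smul (by fun_prop)
  · have h : Continuous fun q : {v : Fin 3 → ℂ // v ≠ 0} × {v : Fin 3 → ℂ // v ≠ 0} ↦
        minor f g (q.1.1, q.2.1) := by
      fun_prop
    exact (h.continuousAt.inv₀ huv).smul (by fun_prop)
  · exact ContinuousAt.div (by fun_prop) (by fun_prop) huv

/-- The convex set of affine coordinates of the points of `chart f g`. -/
def chartTarget (f g : Functional) : Set ((Fin 3 → ℂ) × (Fin 3 → ℂ) × ℂ) :=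
  {c | f c.1 = 1 ∧ f c.2.1 = 0 ∧ g c.2.1 = 1}

theorem convex_chartTarget (f g : Functional) : Convex ℝ (chartTarget f g) := by
  rintro c ⟨hc₁, hc₂, hc₃⟩ d ⟨hd₁, hd₂, hd₃⟩ a b - - hab
  have hab' : (a : ℂ) + b = 1 := by exact_mod_cast hab
  simp [chartTarget, *]

theorem chartCoord_mem_chartTarget {f g : Functional} {p : CP2 × CP2} (hp : p ∈ chart f g) :
    chartCoord f g p ∈ chartTarget f g := by
  obtain ⟨hu, huv⟩ := hp
  refine ⟨?_, ?_, ?_⟩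
  · simp [chartCoord, hu]
  · simp [chartCoord, mul_comm]
  · have h : g (f p.1.rep • p.2.rep - f p.2.rep • p.1.rep) = minor f g (p.1.rep, p.2.rep) := by
      simp [minor, mul_comm]
    simp only [chartCoord, map_smul, h, smul_eq_mul]
    exact inv_mul_cancel₀ huv

/-- The pair of lines with the given affine coordinates. -/
def chartPoint (f g : Functional) (c : chartTarget f g) : {p : CP2 × CP2 // p.1 ≠ p.2} :=
  spanPair ⟨(c.1.1, c.1.2.1 + c.1.2.2 • c.1.1), f, g, by
    obtain ⟨h₁, h₂, h₃⟩ := c.2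
    simp [minor, h₁, h₂, h₃, mul_comm]⟩

theorem continuous_chartPoint (f g : Functional) : Continuous (chartPoint f g) :=
  continuous_spanPair.comp (by fun_prop)

theorem chartPoint_chartCoord {f g : Functional} {x : {p : CP2 × CP2 // p.1 ≠ p.2}}
    (hx : x.1 ∈ chart f g) :
    chartPoint f g ⟨chartCoord f g x.1, chartCoord_mem_chartTarget hx⟩ = x := by
  have hu := hx.1
  have huv := hx.2
  refine Eq.trans (Subtype.ext (Prod.ext ?_ ?_)) (spanPair_rep ⟨f, g, huv⟩)
  · exact CP2.mk_eq_mk_iff.2 ⟨Units.mk0 _ hu, by simp [chartCoord, hu]⟩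
  · refine CP2.mk_eq_mk_iff.2 ⟨Units.mk0 _ (div_ne_zero huv hu), ?_⟩
    simp only
    ext i
    simp [chartCoord]
    field_simp
    ring

theorem homotopic_of_mem_chart {f g : Functional} {x y : {p : CP2 × CP2 // p.1 ≠ p.2}}
    (p q : Path x y) (hp : ∀ t, (p t).1 ∈ chart f g) (hq : ∀ t, (q t).1 ∈ chart f g) :
    p.Homotopic q := by
  have hcoord (r : Path x y) (hr : ∀ t, (r t).1 ∈ chart f g) :
      Continuous fun t ↦ (⟨chartCoord f g (r t).1, chartCoord_mem_chartTarget (hr t)⟩ :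
        chartTarget f g) :=
    ((continuousOn_chartCoord f g).comp_continuous (by fun_prop) hr).subtype_mk _
  have hx : x.1 ∈ chart f g := by simpa using hp 0
  have hy : y.1 ∈ chart f g := by simpa using hp 1
  let lift (r : Path x y) (hr : ∀ t, (r t).1 ∈ chart f g) :
      Path (⟨chartCoord f g x.1, chartCoord_mem_chartTarget hx⟩ : chartTarget f g)
        ⟨chartCoord f g y.1, chartCoord_mem_chartTarget hy⟩ :=
    { toFun := fun t ↦ ⟨chartCoord f g (r t).1, chartCoord_mem_chartTarget (hr t)⟩
      continuous_toFun := hcoord r hr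
      source' := by simp
      target' := by simp }
  have : ContractibleSpace (chartTarget f g) :=
    (convex_chartTarget f g).contractibleSpace ⟨_, chartCoord_mem_chartTarget hx⟩
  have h := (SimplyConnectedSpace.paths_homotopic (lift p hp) (lift q hq)).map
    ⟨chartPoint f g, continuous_chartPoint f g⟩
  have h' := h.pathCast (chartPoint_chartCoord hx).symm (chartPoint_chartCoord hy).symm
  convert h' using 1
  · ext1
    funext t
    exact (chartPoint_chartCoord (hp t)).symm
  · ext1
    funext t
    exact (chartPoint_chartCoord (hq t)).symm

theorem simplyConnectedSpace_pairs (x₀ : {p : CP2 × CP2 // p.1 ≠ p.2}) :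
    SimplyConnectedSpace {p : CP2 × CP2 // p.1 ≠ p.2} := by
  refine simplyConnectedSpace_of_openCover
    (fun i : {i : Functional × Functional // x₀.1 ∈ chart i.1 i.2} ↦
      Subtype.val ⁻¹' chart i.1.1 i.1.2)
    (fun i ↦ (isOpen_chart _ _).preimage continuous_subtype_val) (fun x ↦ ?_) x₀
    (fun i j y hy ↦ joinedIn_chart_inter_chart ⟨i.2, j.2⟩ hy)
    (fun i x y p q hp hq ↦ homotopic_of_mem_chart p q hp hq)
  obtain ⟨f, g, h₀, h⟩ := exists_mem_chart_and_mem_chart x₀.2 x.2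
  exact ⟨⟨(f, g), h₀⟩, h⟩

/-- The coordinate swap on pairs of distinct lines. -/
def swapPair (x : {p : CP2 × CP2 // p.1 ≠ p.2}) : {p : CP2 × CP2 // p.1 ≠ p.2} :=
  ⟨x.1.swap, x.2.symm⟩

theorem swapPair_swapPair (x : {p : CP2 × CP2 // p.1 ≠ p.2}) : swapPair (swapPair x) = x := rfl

theorem swapPair_ne (x : {p : CP2 × CP2 // p.1 ≠ p.2}) : swapPair x ≠ x :=
  fun h ↦ x.2 (congrArg (fun y ↦ y.1.2) h)

theorem continuous_swapPair : Continuous swapPair :=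
  (continuous_swap.comp continuous_subtype_val).subtype_mk _

/-- The action of `ℤˣ = {1, -1}` on pairs of distinct lines by swapping the coordinates. -/
noncomputable instance : MulAction ℤˣ {p : CP2 × CP2 // p.1 ≠ p.2} where
  smul g x := if g = 1 then x else swapPair x
  one_smul x := if_pos rfl
  mul_smul g h x := by
    change ite _ _ _ = ite _ (ite _ _ _) (swapPair (ite _ _ _))
    rcases Int.units_eq_one_or g with rfl | rfl <;> rcases Int.units_eq_one_or h with rfl | rfl <;>
      simp [swapPair_swapPair]

theorem neg_one_smul_pair (x : {p : CP2 × CP2 // p.1 ≠ p.2}) : (-1 : ℤˣ) • x = swapPair x :=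
  if_neg (by decide)

theorem isQuotientCoveringMap_swapSetoid : IsQuotientCoveringMap (Quotient.mk swapSetoid) ℤˣ where
  toIsQuotientMap := isQuotientMap_quotient_mk'
  continuous_const_smul g := by
    rcases Int.units_eq_one_or g with rfl | rfl
    · simpa using continuous_id'
    · simpa only [neg_one_smul_pair] using continuous_swapPair
  apply_eq_iff_mem_orbit {x y} := by
    rw [Quotient.eq]
    constructor
    · rintro (h | h)
      · exact ⟨1, by simpa using Subtype.ext h⟩
      · refine ⟨-1, ?_⟩
        simp only [neg_one_smul_pair]
        exact Subtype.ext (by simp [swapPair, h])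
    · rintro ⟨g, rfl⟩
      rcases Int.units_eq_one_or g with rfl | rfl
      · exact Or.inl (by simp)
      · exact Or.inr (by simp [neg_one_smul_pair, swapPair])
  disjoint x := by
    obtain ⟨V, W, hV, hW, hxV, hxW, hVW⟩ := t2_separation (swapPair_ne x)
    refine ⟨W ∩ swapPair ⁻¹' V, inter_mem (hW.mem_nhds hxW)
      ((hV.preimage continuous_swapPair).mem_nhds hxV), fun g hg ↦ ?_⟩
    rcases Int.units_eq_one_or g with rfl | rfl
    · rfl
    · obtain ⟨_, ⟨y, hy, rfl⟩, hy'⟩ := hg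
      simp only [neg_one_smul_pair] at hy'
      exact (disjoint_left.1 hVW hy.2 hy'.1).elim

/-- Let `P` be the complex projective plane (the projectivization of `ℂ³`
with its quotient topology), let `X = {(a,b) ∈ P × P : a ≠ b}` be the complement of the
diagonal with the subspace topology, and let `Y` be the quotient of `X` by the `ℤ/2`-action
swapping the two coordinates, with the quotient topology. Then the fundamental group of `Y`
at any basepoint is isomorphic to `ℤ/2ℤ`. -/
theorem stmt10 (y : SigmaLocus) :
    Nonempty (FundamentalGroup SigmaLocus y ≃* Multiplicative (ZMod 2)) := by
  obtain ⟨x, rfl⟩ := Quotient.mk_surjective y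
  have := simplyConnectedSpace_pairs x
  have e := isQuotientCoveringMap_swapSetoid.fundamentalGroupEquiv
    (⟨x, rfl⟩ : Quotient.mk swapSetoid ⁻¹' {Quotient.mk swapSetoid x})
  have hcard : Nat.card ℤˣᵐᵒᵖ = 2 := by
    rw [Nat.card_congr MulOpposite.opEquiv.symm, Nat.card_eq_fintype_card, Fintype.card_units_int]
  exact ⟨e.trans (mulEquivOfPrimeCardEq hcard (Nat.card_zmod 2))⟩
end
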